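/- arXiv:2010.02291 — 2 statements merged into one kernel-verified Lean document; each statement's English description precedes it below -/
import Mathlib

section
/- Let E be a real inner product space, let I and J be finite index sets, and let f_i : E → ℝ (i ∈ I) and g_j : E → ℝ (j ∈ J) be convex functions differentiable at a point a ∈ E. Let l_i ≥ 0 (i ∈ I) and m_j ≥ 0 (j ∈ J) be multipliers satisfying complementarity: l_i ≠ 0 implies f_i(a) = 0, and m_j ≠ 0 implies g_j(a) = 0. Suppose α := Σ_{i∈I} l_i ∇f_i(a) satisfies α = −Σ_{j∈J} m_j ∇g_j(a). Then the hyperplane through a with normal α separates the sets F = {x : f_i(x) ≤ 0 for all i} and G = {y : g_j(y) ≤ 0 for all j}: for every x ∈ F, ⟪α, x − a⟫ ≤ 0, and for every y ∈ G, ⟪α, y − a⟫ ≥ 0. -/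
theorem kkt_aux
    {E : Type*} [NormedAddCommGroup E] [InnerProductSpace ℝ E] [CompleteSpace E]
    (f : E → ℝ) (f' a x : E) (hc : ConvexOn ℝ Set.univ f)
    (hf : HasGradientAt f f' a) : inner ℝ f' (x - a) ≤ f x - f a := by
  have h1 : ConvexOn ℝ Set.univ (f ∘ AffineMap.lineMap (k := ℝ) a x) := by
    simpa using hc.comp_affineMap (AffineMap.lineMap (k := ℝ) a x)
  have h2 : HasDerivAt (f ∘ AffineMap.lineMap (k := ℝ) a x) (inner ℝ f' (x - a)) 0 := by
    have h3 : HasDerivAt (AffineMap.lineMap (k := ℝ) a x) (x - a) (0 : ℝ) :=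
      AffineMap.hasDerivAt_lineMap
    have h4 := hf.hasFDerivAt
    have h5 : AffineMap.lineMap (k := ℝ) a x 0 = a := by simp
    rw [← h5] at h4
    simpa using h4.comp_hasDerivAt (0 : ℝ) h3
  have h := h1.le_slope_of_hasDerivAt (Set.mem_univ 0) (Set.mem_univ 1) zero_lt_one h2
  simpa [slope_def_field] using h

theorem kkt_aux_sum
    {E : Type*} [NormedAddCommGroup E] [InnerProductSpace ℝ E] [CompleteSpace E]
    {I : Type*} [Fintype I]
    (f : I → E → ℝ) (f' : I → E) (a : E)
    (hfconv : ∀ i, ConvexOn ℝ Set.univ (f i))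
    (hf' : ∀ i, HasGradientAt (f i) (f' i) a)
    (l : I → ℝ) (hl : ∀ i, 0 ≤ l i)
    (hlc : ∀ i, l i ≠ 0 → f i a = 0) (x : E) (hx : ∀ i, f i x ≤ 0) :
    inner ℝ (∑ i, l i • f' i) (x - a) ≤ (0 : ℝ) := by
  rw [sum_inner]
  refine Finset.sum_nonpos fun i _ => ?_
  rw [real_inner_smul_left]
  by_cases h : l i = 0
  · simp [h]
  · have h1 := kkt_aux (f i) (f' i) a x (hfconv i) (hf' i)
    rw [hlc i h] at h1
    exact mul_nonpos_of_nonneg_of_nonpos (hl i) (by linarith [hx i])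

/-- KKT-type contact multipliers produce a separating hyperplane through
the touching point `a`: `F` lies in `{x | ⟪α, x - a⟫ ≤ 0}` and `G` lies in
`{y | ⟪α, y - a⟫ ≥ 0}`. -/
theorem separating_hyperplane_of_kkt
    {E : Type*} [NormedAddCommGroup E] [InnerProductSpace ℝ E] [CompleteSpace E]
    {I J : Type*} [Fintype I] [Fintype J]
    (f : I → E → ℝ) (g : J → E → ℝ) (f' : I → E) (g' : J → E) (a : E)
    (hfconv : ∀ i, ConvexOn ℝ Set.univ (f i))
    (hgconv : ∀ j, ConvexOn ℝ Set.univ (g j))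
    (hf' : ∀ i, HasGradientAt (f i) (f' i) a)
    (hg' : ∀ j, HasGradientAt (g j) (g' j) a)
    (l : I → ℝ) (m : J → ℝ) (hl : ∀ i, 0 ≤ l i) (hm : ∀ j, 0 ≤ m j)
    (hlc : ∀ i, l i ≠ 0 → f i a = 0) (hmc : ∀ j, m j ≠ 0 → g j a = 0)
    (α : E) (hα : α = ∑ i, l i • f' i)
    (hopp : α = -∑ j, m j • g' j) :
    (∀ x : E, (∀ i, f i x ≤ 0) → inner ℝ α (x - a) ≤ (0 : ℝ)) ∧
    (∀ y : E, (∀ j, g j y ≤ 0) → (0 : ℝ) ≤ inner ℝ α (y - a)) := by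
  constructor
  · intro x hx
    rw [hα]
    exact kkt_aux_sum f f' a hfconv hf' l hl hlc x hx
  · intro y hy
    rw [hopp, inner_neg_left]
    linarith [kkt_aux_sum g g' a hgconv hg' m hm hmc y hy]
end

section
/- Let A, n : Fin 3 → ℝ be vectors in ℝ³ and let [A]ₓ denote the 3×3 skew-symmetric cross-product matrix of A (so that [A]ₓ v = A × v for all v). Let D be the 4×4 real matrix whose upper-left 3×3 block is the transpose of [A]ₓ, whose last column has first three entries equal to n and fourth entry 0, and whose last row has first three entries equal to n and fourth entry 0. Then det D = −(A · n)²; in particular, D is invertible if and only if A · n ≠ 0. -/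
open Matrix

/-- Let `[A]ₓ` be the cross-product matrix of `A` (i.e. `[A]ₓ *ᵥ v = A × v`
for all `v`), and let `D` be the bordered 4×4 matrix with upper-left block `[A]ₓᵀ`,
last column `(n, 0)` and last row `(n, 0)`. Then `det D = -(A ⬝ᵥ n)²`; in particular
`D` is invertible iff `A ⬝ᵥ n ≠ 0`. -/
theorem bordered_cross_matrix_det
    (A n : Fin 3 → ℝ) (M : Matrix (Fin 3) (Fin 3) ℝ)
    (hM : ∀ v : Fin 3 → ℝ, M *ᵥ v = crossProduct A v) :
    (fromBlocks Mᵀ (replicateCol (Fin 1) n) (replicateRow (Fin 1) n) 0).det = -(A ⬝ᵥ n) ^ 2 ∧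
    (IsUnit (fromBlocks Mᵀ (replicateCol (Fin 1) n) (replicateRow (Fin 1) n)
      (0 : Matrix (Fin 1) (Fin 1) ℝ)) ↔ A ⬝ᵥ n ≠ 0) := by
  have hMe : M = !![0, -A 2, A 1; A 2, 0, -A 0; -A 1, A 0, 0] := by
    ext i j
    have h := congrFun (hM (Pi.single j 1)) i
    rw [Matrix.mulVec_single_one] at h
    change M i j = _ at h
    rw [h, cross_apply]
    fin_cases i <;> fin_cases j <;> simp [Pi.single_apply]
  have hdet : (fromBlocks Mᵀ (replicateCol (Fin 1) n) (replicateRow (Fin 1) n)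
      (0 : Matrix (Fin 1) (Fin 1) ℝ)).det = -(A ⬝ᵥ n) ^ 2 := by
    have hD : fromBlocks Mᵀ (replicateCol (Fin 1) n) (replicateRow (Fin 1) n)
        (0 : Matrix (Fin 1) (Fin 1) ℝ) =
        (!![0, A 2, -A 1, n 0; -A 2, 0, A 0, n 1; A 1, -A 0, 0, n 2; n 0, n 1, n 2, 0]).submatrix
          (finSumFinEquiv : Fin 3 ⊕ Fin 1 ≃ Fin 4) finSumFinEquiv := by
      rw [hMe]
      ext i j
      rcases i with i | i <;> rcases j with j | j <;> fin_cases i <;> fin_cases j <;> rfl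
    rw [hD, Matrix.det_submatrix_equiv_self, Matrix.det_succ_row_zero]
    simp [Fin.sum_univ_succ, Matrix.det_fin_three, Fin.succAbove, dotProduct]
    ring
  refine ⟨hdet, ?_⟩
  rw [Matrix.isUnit_iff_isUnit_det, hdet, isUnit_iff_ne_zero]
  simp
end
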